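/- arXiv:1811.02466 — 7 statements merged into one kernel-verified Lean document; each statement's English description precedes it below -/
import Mathlib

section
/- Let k be an algebraically closed field and let K be a field which is an algebra over the rational function field k(t), finite-dimensional as a k(t)-vector space. Let n ≥ 1 and let f_1, …, f_c be homogeneous polynomials in K[x_0, …, x_n] of degrees d_1, …, d_c ≥ 1 with d_1 + ⋯ + d_c ≤ n. Then there exists a nonzero vector a = (a_0, …, a_n) ∈ K^{n+1} such that f_i(a_0, …, a_n) = 0 for every i = 1, …, c. -/
open MvPolynomial

section AffineSpace

variable {σ k : Type*} [Field k]

/-- The endomorphism of the polynomial ring that kills the variables indexed by `s`. -/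
noncomputable def killVars (k : Type*) [Field k] (s : Set σ) :
    MvPolynomial σ k →ₐ[k] MvPolynomial σ k :=
  open Classical in aeval fun i => if i ∈ s then 0 else X i

theorem card_le_height_ker_killVars [Finite σ] (s : Finset σ) :
    (s.card : ℕ∞) ≤ (RingHom.ker (killVars k (s : Set σ))).height := by
  classical
  induction s using Finset.induction_on with
  | empty => simp
  | insert a s ha ih =>
    rw [Finset.card_insert_of_notMem ha, Nat.cast_add, Nat.cast_one]
    have hprime (t : Finset σ) : (RingHom.ker (killVars k (t : Set σ))).IsPrime :=
      RingHom.ker_isPrime _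
    have := hprime s
    have := hprime (insert a s)
    refine (add_le_add_left ih 1).trans (Ideal.height_add_one_le_of_lt_of_isPrime ?_)
    refine lt_of_le_of_ne ?_ fun h => ?_
    · have hcomp : (killVars k ((insert a s : Finset σ) : Set σ)) =
          (killVars k ((insert a s : Finset σ) : Set σ)).comp (killVars k (s : Set σ)) := by
        ext1 i
        by_cases hi : i ∈ s <;> simp [killVars, hi]
      intro p hp
      rw [RingHom.mem_ker] at hp ⊢
      rw [hcomp, AlgHom.comp_apply, hp, map_zero]
    · have hX : (X a : MvPolynomial σ k) ∈
          RingHom.ker (killVars k ((insert a s : Finset σ) : Set σ)) := by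
        simp [RingHom.mem_ker, killVars]
      rw [← h, RingHom.mem_ker] at hX
      simp [killVars, ha, X_ne_zero] at hX

theorem killVars_univ (p : MvPolynomial σ k) :
    killVars k (Set.univ : Set σ) p = C (eval 0 p) := by
  have : killVars k (Set.univ : Set σ) = (Algebra.ofId k _).comp (aeval (0 : σ → k)) := by
    ext1 i
    simp [killVars]
  rw [this]
  simp [Algebra.ofId_apply, aeval_eq_eval]

theorem card_le_height_vanishingIdeal_zero [Fintype σ] :
    (Fintype.card σ : ℕ∞) ≤ (vanishingIdeal k {(0 : σ → k)}).height := by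
  have h := card_le_height_ker_killVars (k := k) (Finset.univ : Finset σ)
  have heq : RingHom.ker (killVars k ((Finset.univ : Finset σ) : Set σ)) =
      vanishingIdeal k {(0 : σ → k)} := by
    ext p
    rw [Finset.coe_univ, RingHom.mem_ker, killVars_univ, mem_vanishingIdeal_singleton_iff,
      aeval_eq_eval]
    simp
  rwa [heq] at h

/-- Over an algebraically closed field, fewer polynomials vanishing at the origin than there are
variables have a common zero other than the origin. -/
theorem exists_ne_zero_eval_eq_zero_of_card_lt [IsAlgClosed k] {ι : Type*} [Fintype ι] [Fintype σ]
    (h : Fintype.card ι < Fintype.card σ) (p : ι → MvPolynomial σ k)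
    (hp : ∀ i, eval 0 (p i) = 0) : ∃ a : σ → k, a ≠ 0 ∧ ∀ i, eval a (p i) = 0 := by
  classical
  by_contra! hne
  set I : Ideal (MvPolynomial σ k) := Ideal.span (Set.range p) with hI
  have hz : zeroLocus k I = {0} := by
    ext a
    simp only [hI, zeroLocus_span, Set.mem_singleton_iff]
    constructor
    · intro ha
      by_contra h0
      obtain ⟨i, hi⟩ := hne a h0
      exact hi (by simpa [aeval_eq_eval] using ha (p i) ⟨i, rfl⟩)
    · rintro rfl _ ⟨i, rfl⟩
      simpa [aeval_eq_eval] using hp i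
  have hrad : vanishingIdeal k {(0 : σ → k)} = I.radical := by
    rw [← hz, vanishingIdeal_zeroLocus_eq_radical]
  have hmin : vanishingIdeal k {(0 : σ → k)} ∈ I.minimalPrimes := by
    refine ⟨⟨inferInstance, hrad ▸ Ideal.le_radical⟩, fun q hq _ => ?_⟩
    rw [hrad]
    exact hq.1.radical_le_iff.mpr hq.2
  have hle := Ideal.height_le_card_of_mem_minimalPrimes_span (Set.finite_range p) hmin
  have hcard : (Set.range p).ncard ≤ Fintype.card ι := by
    rw [← Set.image_univ, ← Nat.card_eq_fintype_card, ← Set.ncard_univ]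
    exact Set.ncard_image_le Set.finite_univ
  have := (card_le_height_vanishingIdeal_zero (k := k) (σ := σ)).trans hle
  rw [Nat.cast_le] at this
  omega

end AffineSpace

/-- Substituting linear combinations `∑ s, y (j, s) • e s` of elements of an `R`-algebra `A` into a
form over `A` and applying an `R`-linear functional gives a form over `R` in the `y (j, s)`. -/
theorem MvPolynomial.IsHomogeneous.exists_eval_eq_apply_eval_sum_smul {R A σ τ : Type*}
    [CommRing R] [CommRing A] [Algebra R A] [Fintype τ] (e : τ → A) (φ : A →ₗ[R] R)
    {f : MvPolynomial σ A} {d : ℕ} (hf : f.IsHomogeneous d) :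
    ∃ g : MvPolynomial (σ × τ) R, g.IsHomogeneous d ∧
      ∀ y, eval y g = φ (eval (fun j => ∑ s, y (j, s) • e s) f) := by
  classical
  set h : MvPolynomial (σ × τ) A := MvPolynomial.aeval (fun j => ∑ s, C (e s) * X (j, s)) f with hh
  have hhom : h.IsHomogeneous d := by
    rw [← one_mul d]
    exact hf.aeval _ fun j => IsHomogeneous.sum _ _ _ fun s _ => isHomogeneous_C_mul_X _ _
  refine ⟨∑ m ∈ h.support, monomial m (φ (coeff m h)), IsHomogeneous.sum _ _ _ fun m hm =>
    isHomogeneous_monomial _ ?_, fun y => ?_⟩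
  · by_contra hne
    exact (mem_support_iff.mp hm) (hhom.coeff_eq_zero hne)
  · have heval : eval (fun j => ∑ s, y (j, s) • e s) f =
        eval (fun q => algebraMap R A (y q)) h := by
      rw [hh, ← aeval_eq_eval, ← aeval_eq_eval, ← AlgHom.comp_apply]
      refine DFunLike.congr_fun ?_ f
      ext1 j
      simp [Algebra.smul_def, mul_comm]
    rw [heval, map_sum, eval_eq, map_sum]
    refine Finset.sum_congr rfl fun m _ => ?_
    rw [eval_monomial, Finsupp.prod, mul_comm (coeff m h)]
    simp_rw [← map_pow]
    rw [← map_prod, ← Algebra.smul_def, map_smul, smul_eq_mul, mul_comm]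

theorem natDegree_eval_le {R σ : Type*} [CommRing R] {f : MvPolynomial σ (Polynomial R)}
    {d D S : ℕ} (hf : f.IsHomogeneous d) (hD : ∀ m, (coeff m f).natDegree ≤ D)
    {x : σ → Polynomial R} (hx : ∀ j, (x j).natDegree ≤ S) :
    (eval x f).natDegree ≤ D + d * S := by
  rw [eval_eq]
  refine Polynomial.natDegree_sum_le_of_forall_le _ _ fun m hm => ?_
  refine Polynomial.natDegree_mul_le.trans (add_le_add (hD m) ?_)
  refine (Polynomial.natDegree_prod_le _ _).trans ?_
  have hdeg : ∑ j ∈ m.support, m j = d := by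
    rw [← Finsupp.degree_apply]
    by_contra hne
    exact (mem_support_iff.mp hm) (hf.coeff_eq_zero hne)
  rw [← hdeg, Finset.sum_mul]
  exact Finset.sum_le_sum fun j _ => Polynomial.natDegree_pow_le_of_le _ (hx j)

theorem MvPolynomial.IsHomogeneous.eval_zero_eq_zero {R σ : Type*} [CommRing R]
    {f : MvPolynomial σ R} {d : ℕ} (hf : f.IsHomogeneous d) (hd : d ≠ 0) : eval 0 f = 0 := by
  rw [eval_zero, constantCoeff_eq]
  exact hf.coeff_eq_zero (by simpa using hd.symm)

section Tsen

variable {k : Type*} [Field k] [IsAlgClosed k] {σ ι : Type*} [Fintype σ] [Fintype ι]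

theorem exists_ne_zero_eval_eq_zero_polynomial {d : ι → ℕ} (hd : ∀ i, d i ≠ 0)
    (hsum : ∑ i, d i < Fintype.card σ) {f : ι → MvPolynomial σ (Polynomial k)}
    (hf : ∀ i, (f i).IsHomogeneous (d i)) :
    ∃ a : σ → Polynomial k, a ≠ 0 ∧ ∀ i, eval a (f i) = 0 := by
  classical
  obtain ⟨D, hD⟩ : ∃ D, ∀ i m, (coeff m (f i)).natDegree ≤ D := by
    refine ⟨Finset.univ.sup fun i => (f i).support.sup fun m => (coeff m (f i)).natDegree,
      fun i m => ?_⟩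
    by_cases hm : m ∈ (f i).support
    · exact (Finset.le_sup (f := fun m => (coeff m (f i)).natDegree) hm).trans
        (Finset.le_sup (f := fun i => (f i).support.sup fun m => (coeff m (f i)).natDegree)
          (Finset.mem_univ i))
    · rw [notMem_support_iff.mp hm]
      simp
  set S := Fintype.card ι * (D + 1) with hS
  choose g hg hgeval using fun q : Σ i, Fin (D + d i * S + 1) =>
    (hf q.1).exists_eval_eq_apply_eval_sum_smul (R := k)
      (fun s : Fin (S + 1) => (Polynomial.X : Polynomial k) ^ (s : ℕ))
      (Polynomial.lcoeff k (q.2 : ℕ))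
  have hcard : Fintype.card (Σ i, Fin (D + d i * S + 1)) < Fintype.card (σ × Fin (S + 1)) := by
    have : ∑ i, (D + d i * S + 1) = S + (∑ i, d i) * S := by
      simp only [Finset.sum_add_distrib, ← Finset.sum_mul, Finset.sum_const, Finset.card_univ,
        smul_eq_mul, hS]
      ring
    simp only [Fintype.card_sigma, Fintype.card_fin, Fintype.card_prod, this]
    have := Nat.mul_le_mul_right (S + 1) (Nat.succ_le_of_lt hsum)
    rw [Nat.succ_mul, mul_add_one] at this
    omega
  obtain ⟨y, hy0, hy⟩ := exists_ne_zero_eval_eq_zero_of_card_lt hcard g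
    fun q => (hg q).eval_zero_eq_zero (hd q.1)
  refine ⟨fun j => ∑ s, y (j, s) • Polynomial.X ^ (s : ℕ), fun h0 => hy0 ?_, fun i => ?_⟩
  · ext ⟨j, s⟩
    have := congrArg (fun p => Polynomial.coeff p (s : ℕ)) (congrFun h0 j)
    simpa [Polynomial.finsetSum_coeff, Polynomial.coeff_X_pow, Fin.val_inj] using this
  · ext l
    rw [Polynomial.coeff_zero]
    by_cases hl : l < D + d i * S + 1
    · have := hy ⟨i, l, hl⟩
      rwa [hgeval, Polynomial.lcoeff_apply] at this
    · refine Polynomial.coeff_eq_zero_of_natDegree_lt (lt_of_le_of_lt ?_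
        (Nat.lt_of_succ_le (not_lt.mp hl)))
      refine natDegree_eval_le (hf i) (hD i) fun j => ?_
      refine Polynomial.natDegree_sum_le_of_forall_le _ _ fun s _ => ?_
      refine (Polynomial.natDegree_smul_le _ _).trans ?_
      rw [Polynomial.natDegree_X_pow]
      exact Nat.lt_succ_iff.mp s.2

theorem exists_ne_zero_eval_eq_zero_ratFunc {d : ι → ℕ} (hd : ∀ i, d i ≠ 0)
    (hsum : ∑ i, d i < Fintype.card σ) {f : ι → MvPolynomial σ (RatFunc k)}
    (hf : ∀ i, (f i).IsHomogeneous (d i)) :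
    ∃ a : σ → RatFunc k, a ≠ 0 ∧ ∀ i, eval a (f i) = 0 := by
  classical
  have hinj := IsFractionRing.injective (Polynomial k) (RatFunc k)
  have hclear (i : ι) : ∃ b : Polynomial k, b ≠ 0 ∧ ∃ g : MvPolynomial σ (Polynomial k),
      map (algebraMap (Polynomial k) (RatFunc k)) g = C (algebraMap _ _ b) * f i := by
    obtain ⟨b, hb⟩ := IsLocalization.exist_integer_multiples (nonZeroDivisors (Polynomial k))
      (f i).support fun m => coeff m (f i)
    choose! c hc using hb
    refine ⟨b, nonZeroDivisors.coe_ne_zero b, ∑ m ∈ (f i).support, monomial m (c m), ?_⟩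
    conv_rhs => rw [(f i).as_sum]
    rw [map_sum, Finset.mul_sum]
    refine Finset.sum_congr rfl fun m hm => ?_
    rw [map_monomial, hc m hm, C_mul_monomial, Algebra.smul_def]
  choose b hb g hg using hclear
  have hghom (i : ι) : (g i).IsHomogeneous (d i) :=
    IsHomogeneous.of_map hinj (hg i ▸ (hf i).C_mul _)
  obtain ⟨a, ha0, ha⟩ := exists_ne_zero_eval_eq_zero_polynomial hd hsum hghom
  refine ⟨fun j => algebraMap _ _ (a j), fun h0 => ha0 ?_, fun i => ?_⟩
  · ext1 j
    exact hinj (by simpa using congrFun h0 j)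
  · have h := congrArg (eval fun j => algebraMap (Polynomial k) (RatFunc k) (a j)) (hg i)
    rw [eval_map, ← Function.comp_def, ← eval₂_comp, ha i, map_zero, map_mul, eval_C] at h
    exact (mul_eq_zero.mp h.symm).resolve_left fun h0 => hb i (hinj (by simpa using h0))

end Tsen

/-- **Tsen's theorem.** Over a field `K` that is a finite extension of the rational
function field `k(t)` of an algebraically closed field `k`, any system of homogeneous
polynomials `f 1, …, f c` in `n + 1` variables of degrees `d 1, …, d c ≥ 1` with
`d 1 + ⋯ + d c ≤ n` has a nontrivial common zero. -/
theorem tsen_theorem (k : Type*) [Field k] [IsAlgClosed k]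
    (K : Type*) [Field K] [Algebra (RatFunc k) K] [FiniteDimensional (RatFunc k) K]
    (n c : ℕ) (hn : 1 ≤ n)
    (d : Fin c → ℕ) (hd : ∀ i, 1 ≤ d i) (hsum : ∑ i, d i ≤ n)
    (f : Fin c → MvPolynomial (Fin (n + 1)) K)
    (hf : ∀ i, (f i).IsHomogeneous (d i)) :
    ∃ a : Fin (n + 1) → K, a ≠ 0 ∧ ∀ i, MvPolynomial.eval a (f i) = 0 := by
  classical
  let e := Module.finBasis (RatFunc k) K
  choose g hg hgeval using fun q : Fin c × Fin (Module.finrank (RatFunc k) K) =>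
    (hf q.1).exists_eval_eq_apply_eval_sum_smul (R := RatFunc k) e (e.coord q.2)
  have hcard : ∑ q : Fin c × Fin (Module.finrank (RatFunc k) K), d q.1 <
      Fintype.card (Fin (n + 1) × Fin (Module.finrank (RatFunc k) K)) := by
    have hpos : 0 < Module.finrank (RatFunc k) K := Module.finrank_pos
    simp only [Fintype.sum_prod_type, Finset.sum_const, Finset.card_univ, Fintype.card_fin,
      smul_eq_mul, Fintype.card_prod, ← Finset.mul_sum]
    nlinarith
  obtain ⟨y, hy0, hy⟩ := exists_ne_zero_eval_eq_zero_ratFunc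
    (ι := Fin c × Fin (Module.finrank (RatFunc k) K)) (d := fun q => d q.1)
    (fun q => Nat.one_le_iff_ne_zero.mp (hd q.1)) hcard hg
  refine ⟨fun j => ∑ s, y (j, s) • e s, fun h0 => hy0 ?_, fun i => ?_⟩
  · ext ⟨j, s⟩
    exact Fintype.linearIndependent_iff.mp e.linearIndependent _ (congrFun h0 j) s
  · refine e.ext_elem fun l => ?_
    have := hy (i, l)
    rw [hgeval, Module.Basis.coord_apply] at this
    rw [this, map_zero, Finsupp.zero_apply]
end

section
/- Let p be a prime number, let v ≥ 1 and let e be a natural number with e > p and p not dividing e. Let d be a natural number with d + 1 = p^(v−1)·e and with p not dividing d. Then there exists a natural number ℓ with 1 ≤ ℓ ≤ d − 1 such that p divides the binomial coefficient C(d, ℓ). -/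
/-- If `d` is `p`-prime and `d + 1 = p ^ (v - 1) * e` is `p`-nonspecial (`e > p`,
`p ∤ e`, `v ≥ 1`), then some binomial coefficient `C(d, ℓ)` with `1 ≤ ℓ ≤ d - 1`
is divisible by `p`. -/
theorem exists_prime_dvd_choose_of_nonspecial_succ (p v e d : ℕ) (hp : p.Prime)
    (hv : 1 ≤ v) (he : p < e) (hpe : ¬ p ∣ e) (hd : d + 1 = p ^ (v - 1) * e)
    (hpd : ¬ p ∣ d) :
    ∃ ℓ : ℕ, 1 ≤ ℓ ∧ ℓ ≤ d - 1 ∧ p ∣ d.choose ℓ := by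
  obtain ⟨w, rfl⟩ := Nat.exists_eq_add_of_le' hv
  rw [Nat.add_sub_cancel] at hd
  have hpos : 0 < p ^ w := pow_pos hp.pos w
  have hlt : p ^ (w + 1) < d + 1 := by
    rw [hd, pow_succ]
    exact Nat.mul_lt_mul_of_pos_left he hpos
  have htwo : 1 < p ^ (w + 1) := Nat.one_lt_pow w.succ_ne_zero hp.one_lt
  refine ⟨p ^ (w + 1) - 1, by omega, by omega, ?_⟩
  have hmul := Nat.add_one_mul_choose_eq d (p ^ (w + 1) - 1)
  rw [Nat.sub_add_cancel htwo.le, hd] at hmul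
  have hcancel : e * d.choose (p ^ (w + 1) - 1) =
      p * (p ^ w * e).choose (p ^ (w + 1)) := by
    apply Nat.eq_of_mul_eq_mul_left hpos
    rw [← mul_assoc, hmul]
    ring
  exact (hp.dvd_mul.mp (Dvd.intro _ hcancel.symm)).resolve_left hpe
end

section
/- Let p be a prime number, let v ≥ 2 and let e be a natural number with e > p and p not dividing e. Let d = p^(v−1)·e. Then there exists a natural number ℓ with 1 ≤ ℓ ≤ d − 1 such that p divides all three binomial coefficients C(d−1, ℓ), C(d−1, ℓ−1), and C(d, ℓ). -/
theorem Nat.Prime.dvd_choose_of_dvd_choose_div_pow {p n k : ℕ} (hp : p.Prime) (a : ℕ)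
    (h : p ∣ (n / p ^ a).choose (k / p ^ a)) : p ∣ n.choose k := by
  have := Fact.mk hp
  have hlucas := Choose.choose_modEq_choose_mul_prod_range_choose (n := n) (k := k) (p := p) a
  have hdvd := hlucas.dvd_iff.mpr ((Int.natCast_dvd_natCast.mpr h).mul_right _)
  exact_mod_cast hdvd

theorem Nat.Prime.dvd_choose_sub_one_sub_one {p e : ℕ} (hp : p.Prime) (hpe : ¬ p ∣ e) :
    p ∣ (e - 1).choose (p - 1) := by
  have := Fact.mk hp
  have hmod : (e - 1) % p < p - 1 := by
    have hlt := Nat.mod_lt (e - 1) hp.pos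
    refine lt_of_le_of_ne (by omega) fun h => hpe ?_
    have he : e ≠ 0 := fun h0 => hpe (h0 ▸ dvd_zero p)
    have hdiv := Nat.div_add_mod (e - 1) p
    exact ⟨(e - 1) / p + 1, by rw [mul_add_one]; have := hp.pos; omega⟩
  have hlucas := Choose.choose_modEq_choose_mod_mul_choose_div_nat
    (n := e - 1) (k := p - 1) (p := p)
  rw [Nat.mod_eq_of_lt (Nat.sub_lt hp.pos one_pos), Nat.choose_eq_zero_of_lt hmod,
    zero_mul] at hlucas
  exact Nat.modEq_zero_iff_dvd.mp hlucas

/-- If `d = p ^ (v - 1) * e` is `p`-divisible and `p`-nonspecial (`v ≥ 2`, `e > p`,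
`p ∤ e`), then there is `ℓ` with `1 ≤ ℓ ≤ d - 1` such that `p` divides all three
binomial coefficients `C(d - 1, ℓ)`, `C(d - 1, ℓ - 1)`, and `C(d, ℓ)`. -/
theorem exists_prime_dvd_three_chooses_of_nonspecial (p v e d : ℕ) (hp : p.Prime)
    (hv : 2 ≤ v) (he : p < e) (hpe : ¬ p ∣ e) (hd : d = p ^ (v - 1) * e) :
    ∃ ℓ : ℕ, 1 ≤ ℓ ∧ ℓ ≤ d - 1 ∧ p ∣ (d - 1).choose ℓ ∧
      p ∣ (d - 1).choose (ℓ - 1) ∧ p ∣ d.choose ℓ := by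
  have hq : 1 < p ^ (v - 1) := Nat.one_lt_pow (by omega) hp.one_lt
  have hchoose := hp.dvd_choose_sub_one_sub_one hpe
  obtain ⟨f, rfl⟩ : ∃ f, e = f + 1 := ⟨e - 1, by omega⟩
  have hd1 : d - 1 = p ^ (v - 1) * f + (p ^ (v - 1) - 1) := by
    rw [hd, mul_add_one]; omega
  have hdiv (r : ℕ) (hr : r < p ^ (v - 1)) (m : ℕ) :
      (p ^ (v - 1) * m + r) / p ^ (v - 1) = m := by
    rw [Nat.mul_add_div (by omega), Nat.div_eq_of_lt hr, add_zero]
  have hdvd (r : ℕ) (hr : r < p ^ (v - 1)) :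
      p ∣ (d - 1).choose (p ^ (v - 1) * (p - 1) + r) := by
    apply hp.dvd_choose_of_dvd_choose_div_pow (v - 1)
    rwa [hd1, hdiv _ (by omega), hdiv r hr]
  have hle : p ^ (v - 1) * (p - 1) ≤ p ^ (v - 1) * f := Nat.mul_le_mul_left _ (by omega)
  refine ⟨p ^ (v - 1) * (p - 1) + 1, by omega, by omega, hdvd 1 hq, hdvd 0 (by omega), ?_⟩
  rw [show d = (d - 1) + 1 by omega, Nat.choose_succ_succ]
  exact dvd_add (hdvd 0 (by omega)) (hdvd 1 hq)
end

section
/- Let k be a field of characteristic p > 0, let d ≥ 2 be an integer divisible by p, and let n ≥ 1. In the polynomial ring k[X_0, …, X_n], with indices taken cyclically modulo n+1, let g_{n;d} = Σ_{j ∈ Z/(n+1)} X_j^(d−1) · X_{j+1}. Then the difference g_{n;d} − (n+1)·X_0^(d−1)·X_1 lies in the ideal of k[X_0, …, X_n] generated by the partial derivatives ∂g_{n;d}/∂X_0, …, ∂g_{n;d}/∂X_n. -/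
open MvPolynomial

/-- The partial derivatives of `∑ j, X j ^ (e + 1) * X (j + 1)`. -/
lemma pderiv_cyclic_poly {k : Type*} [CommRing k] (e m : ℕ) [NeZero m] (i : ZMod m) :
    pderiv i (∑ j : ZMod m, X j ^ (e + 1) * X (j + 1) : MvPolynomial (ZMod m) k) =
      ((e + 1 : ℕ) : MvPolynomial (ZMod m) k) * X i ^ e * X (i + 1) + X (i - 1) ^ (e + 1) := by
  have h (j : ZMod m) : pderiv i (X j ^ (e + 1) * X (j + 1) : MvPolynomial (ZMod m) k) =
      (if j = i then ((e + 1 : ℕ) : MvPolynomial (ZMod m) k) * X j ^ e * X (j + 1) else 0) +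
        (if j = i - 1 then X j ^ (e + 1) else 0) := by
    rw [pderiv_mul, pderiv_pow, pderiv_X, pderiv_X]
    simp only [Pi.single_apply, ← eq_sub_iff_add_eq, Nat.add_sub_cancel]
    split_ifs <;> simp
  rw [map_sum, Finset.sum_congr rfl fun j _ => h j, Finset.sum_add_distrib]
  simp

/-- Multiplying the `i`-th partial derivative by `X i` gives a difference of consecutive
monomials when the degree vanishes in the coefficient ring. -/
lemma X_mul_pderiv_cyclic_poly {k : Type*} [CommRing k] (e m : ℕ) [NeZero m]
    (he : ((e + 2 : ℕ) : k) = 0) (i : ZMod m) :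
    X i * pderiv i (∑ j : ZMod m, X j ^ (e + 1) * X (j + 1) : MvPolynomial (ZMod m) k) =
      X (i - 1) ^ (e + 1) * X i - X i ^ (e + 1) * X (i + 1) := by
  have h : ((e + 2 : ℕ) : MvPolynomial (ZMod m) k) = 0 := by
    rw [← map_natCast (C : k →+* MvPolynomial (ZMod m) k), he, map_zero]
  rw [pderiv_cyclic_poly]
  push_cast at h ⊢
  linear_combination X i ^ (e + 1) * X (i + 1) * h

/-- For `g_{n;d} = ∑_{j ∈ ℤ/(n+1)} X j ^ (d-1) * X (j+1)` over a field of
characteristic `p > 0` with `p ∣ d` and `d ≥ 2`, the difference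
`g_{n;d} - (n+1) • X 0 ^ (d-1) * X 1` lies in the ideal generated by the
partial derivatives of `g_{n;d}`. -/
theorem cyclic_poly_sub_mem_jacobian (k : Type*) [Field k] (p : ℕ) [CharP k p]
    (hp : 0 < p) (d n : ℕ) (hd : 2 ≤ d) (hpd : p ∣ d) (hn : 1 ≤ n)
    (g : MvPolynomial (ZMod (n + 1)) k)
    (hg : g = ∑ j : ZMod (n + 1), X j ^ (d - 1) * X (j + 1)) :
    g - C ((n + 1 : ℕ) : k) * (X 0 ^ (d - 1) * X 1) ∈
      Ideal.span (Set.range fun i : ZMod (n + 1) => pderiv i g) := by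
  obtain ⟨e, rfl⟩ := Nat.exists_eq_add_of_le' hd
  have he : ((e + 2 : ℕ) : k) = 0 := (CharP.cast_eq_zero_iff k p _).2 hpd
  rw [show e + 2 - 1 = e + 1 from rfl] at hg ⊢
  set I := Ideal.span (Set.range fun i : ZMod (n + 1) => pderiv i g)
  have step (i : ZMod (n + 1)) :
      (X (i - 1) ^ (e + 1) * X i - X i ^ (e + 1) * X (i + 1) :
        MvPolynomial (ZMod (n + 1)) k) ∈ I := by
    rw [← X_mul_pderiv_cyclic_poly e (n + 1) he i, ← hg]
    exact I.mul_mem_left _ (Ideal.subset_span ⟨i, rfl⟩)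
  have key (a : ℕ) :
      (X (a : ZMod (n + 1)) ^ (e + 1) * X ((a : ZMod (n + 1)) + 1) - X 0 ^ (e + 1) * X 1 :
        MvPolynomial (ZMod (n + 1)) k) ∈ I := by
    induction a with
    | zero => simp
    | succ a ih =>
      have h := I.sub_mem ih (step ((a + 1 : ℕ) : ZMod (n + 1)))
      push_cast at h ⊢
      rw [add_sub_cancel_right] at h
      convert h using 1
      ring
  have hsum : g - C ((n + 1 : ℕ) : k) * (X 0 ^ (e + 1) * X 1) =
      ∑ j : ZMod (n + 1), (X j ^ (e + 1) * X (j + 1) - X 0 ^ (e + 1) * X 1) := by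
    rw [Finset.sum_sub_distrib, ← hg, Finset.sum_const, Finset.card_univ, ZMod.card,
      nsmul_eq_mul, map_natCast]
  rw [hsum]
  refine I.sum_mem fun j _ => ?_
  simpa only [ZMod.natCast_zmod_val] using key j.val
end

section
/- Let k be a field of characteristic p > 0, let d ≥ 2 be an integer divisible by p, and let n ≥ 1 with p not dividing n+1. In the polynomial ring k[X_0, …, X_n], with indices taken cyclically modulo n+1, let g_{n;d} = Σ_{j ∈ Z/(n+1)} X_j^(d−1) · X_{j+1}. Then for every index i, the variable X_i lies in the radical of the ideal generated by g_{n;d} together with all partial derivatives ∂g_{n;d}/∂X_0, …, ∂g_{n;d}/∂X_n. In particular, this radical is the whole irrelevant ideal (X_0, …, X_n). -/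
open MvPolynomial

/-- The partial derivatives of the cyclic polynomial `∑ j, X j ^ (d - 1) * X (j + 1)`
when `d = 0` in the coefficient field. -/
theorem pderiv_sum_cyclic {k : Type*} [Field k] {d n : ℕ} (hd : 2 ≤ d) (hdk : (d : k) = 0)
    (i : ZMod (n + 1)) :
    pderiv i (∑ j : ZMod (n + 1), X j ^ (d - 1) * X (j + 1) : MvPolynomial (ZMod (n + 1)) k) =
      X (i - 1) ^ (d - 1) - X i ^ (d - 2) * X (i + 1) := by
  have hc : ((d - 1 : ℕ) : MvPolynomial (ZMod (n + 1)) k) = -1 := by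
    rw [Nat.cast_sub (by lia), ← map_natCast (C : k →+* MvPolynomial (ZMod (n + 1)) k), hdk]
    simp
  have hterm (j : ZMod (n + 1)) :
      pderiv i (X j ^ (d - 1) * X (j + 1) : MvPolynomial (ZMod (n + 1)) k) =
        (if j = i - 1 then X j ^ (d - 1) else 0) -
          if j = i then X j ^ (d - 2) * X (j + 1) else 0 := by
    rw [Derivation.leibniz, Derivation.leibniz_pow, pderiv_X, pderiv_X]
    simp only [Pi.single_apply, smul_eq_mul, nsmul_eq_mul, hc, Nat.sub_sub, ← eq_sub_iff_add_eq]
    split_ifs <;> ring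
  simp_rw [map_sum, hterm, Finset.sum_sub_distrib, Finset.sum_ite_eq', Finset.mem_univ, if_true]

/-- A prime ideal containing a cyclic family's relations
`x (i - 1) ^ (d - 1) = x i ^ (d - 2) * x (i + 1)` and the sum of all
`x j ^ (d - 1) * x (j + 1)` contains the whole family. -/
theorem mem_prime_of_cyclic_relations {R : Type*} [CommRing R] (P : Ideal R) [P.IsPrime]
    {d n : ℕ} (hd : 2 ≤ d) (hn : IsUnit ((n + 1 : ℕ) : R)) (hodd : d = 2 → Odd (n + 1))
    (x : ZMod (n + 1) → R) (hsum : ∑ j, x j ^ (d - 1) * x (j + 1) ∈ P)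
    (hrel : ∀ i, x (i - 1) ^ (d - 1) - x i ^ (d - 2) * x (i + 1) ∈ P) (i : ZMod (n + 1)) :
    x i ∈ P := by
  obtain ⟨e, rfl⟩ := Nat.exists_eq_add_of_le' hd
  simp only [Nat.add_sub_cancel, show e + 2 - 1 = e + 1 from rfl] at hsum hrel
  set y : ZMod (n + 1) → R ⧸ P := fun j => Ideal.Quotient.mk P (x j) with hy
  have hrel' (i) : y (i - 1) ^ (e + 1) = y i ^ e * y (i + 1) := by
    simpa [hy] using Ideal.Quotient.eq.2 (hrel i)
  have hstep (i) : y (i + 1) ^ (e + 1) * y (i + 1 + 1) = y i ^ (e + 1) * y (i + 1) := by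
    have h := hrel' (i + 1)
    rw [add_sub_cancel_right] at h
    rw [h]
    ring
  have hconst (m : ℕ) : y m ^ (e + 1) * y (m + 1) = y 0 ^ (e + 1) * y (0 + 1) := by
    induction m with
    | zero => rw [Nat.cast_zero]
    | succ m ih => rw [← ih, ← hstep m, Nat.cast_succ]
  have hall (j : ZMod (n + 1)) : y j ^ (e + 1) * y (j + 1) = y 0 ^ (e + 1) * y (0 + 1) := by
    simpa using hconst j.val
  have hzero : y 0 ^ (e + 1) * y (0 + 1) = 0 := by
    have h : ∑ j, y j ^ (e + 1) * y (j + 1) = 0 := by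
      simpa [hy] using Ideal.Quotient.eq_zero_iff_mem.2 hsum
    simp_rw [hall, Finset.sum_const, Finset.card_univ, ZMod.card, nsmul_eq_mul] at h
    have hu : IsUnit ((n + 1 : ℕ) : R ⧸ P) := by simpa using hn.map (Ideal.Quotient.mk P)
    exact hu.mul_right_eq_zero.1 h
  suffices y i = 0 from Ideal.Quotient.eq_zero_iff_mem.1 this
  have hi : y i ^ (e + 1) * y (i + 1) = 0 := (hall i).trans hzero
  rcases mul_eq_zero.1 hi with h | h
  · exact eq_zero_of_pow_eq_zero h
  rcases Nat.eq_zero_or_pos e with rfl | he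
  · obtain ⟨m, hm⟩ := hodd rfl
    have hper (m : ℕ) : y (i + 1 + 2 * m) = y (i + 1) := by
      induction m with
      | zero => simp
      | succ m ih =>
        have h := hrel' (i + 1 + 2 * m + 1)
        rw [add_sub_cancel_right, zero_add, pow_one, pow_zero, one_mul, ih] at h
        rw [h]
        push_cast
        ring_nf
    have hm' : (1 + 2 * m : ZMod (n + 1)) = 0 := by
      have := congrArg (Nat.cast : ℕ → ZMod (n + 1)) hm
      rw [ZMod.natCast_self] at this
      rw [this]
      push_cast
      ring
    have h' := hper m
    rwa [add_assoc, hm', add_zero, h] at h'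
  · have h' := hrel' (i + 1)
    rw [add_sub_cancel_right, h, zero_pow he.ne', zero_mul] at h'
    exact eq_zero_of_pow_eq_zero h'

/-- The ideal generated by the variables is the kernel of the constant coefficient map. -/
theorem idealOfVars_eq_ker_constantCoeff {σ R : Type*} [CommRing R] :
    idealOfVars σ R = RingHom.ker constantCoeff := by
  ext f
  rw [← pow_one (idealOfVars σ R), mem_pow_idealOfVars_iff', RingHom.mem_ker, constantCoeff_eq]
  simp [Finsupp.degree_eq_zero_iff]

/-- Over a reduced ring, the ideal generated by the variables is radical. -/
theorem isRadical_idealOfVars {σ R : Type*} [CommRing R] [IsReduced R] :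
    (idealOfVars σ R).IsRadical := by
  rw [idealOfVars_eq_ker_constantCoeff]
  exact RingHom.ker_isRadical_iff_reduced_of_surjective (fun r => ⟨C r, constantCoeff_C _ r⟩)
    |>.2 ‹_›

/-- Smoothness of `Zero(g_{n;d})` via the Jacobian criterion when `p ∤ n + 1`:
for `g_{n;d} = ∑_{j ∈ ℤ/(n+1)} X j ^ (d-1) * X (j+1)` over a field of
characteristic `p > 0` with `p ∣ d`, `d ≥ 2`, every variable `X i` lies in the
radical of the ideal generated by `g_{n;d}` and its partial derivatives, and
this radical is the whole irrelevant ideal. -/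
theorem cyclic_poly_jacobian_radical (k : Type*) [Field k] (p : ℕ) [CharP k p]
    (hp : 0 < p) (d n : ℕ) (hd : 2 ≤ d) (hpd : p ∣ d) (hn : 1 ≤ n)
    (hpn : ¬ p ∣ (n + 1))
    (g : MvPolynomial (ZMod (n + 1)) k)
    (hg : g = ∑ j : ZMod (n + 1), X j ^ (d - 1) * X (j + 1)) :
    (∀ i : ZMod (n + 1),
      X i ∈ (Ideal.span ({g} ∪ Set.range fun i : ZMod (n + 1) => pderiv i g)).radical) ∧
    (Ideal.span ({g} ∪ Set.range fun i : ZMod (n + 1) => pderiv i g)).radical =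
      Ideal.span (Set.range (X : ZMod (n + 1) → MvPolynomial (ZMod (n + 1)) k)) := by
  have hdk : (d : k) = 0 := (CharP.cast_eq_zero_iff k p d).2 hpd
  have hunit : IsUnit ((n + 1 : ℕ) : MvPolynomial (ZMod (n + 1)) k) := by
    rw [← map_natCast (C : k →+* MvPolynomial (ZMod (n + 1)) k)]
    exact (IsUnit.mk0 _ fun h => hpn ((CharP.cast_eq_zero_iff k p (n + 1)).1 h)).map C
  have hodd : d = 2 → Odd (n + 1) := by
    rintro rfl
    have hp1 : p ≠ 1 := fun h => hpn (by simp [h])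
    obtain rfl : p = 2 := ((Nat.dvd_prime Nat.prime_two).1 hpd).resolve_left hp1
    exact Nat.not_even_iff_odd.1 fun h => hpn h.two_dvd
  have hX (i : ZMod (n + 1)) :
      X i ∈ (Ideal.span ({g} ∪ Set.range fun i : ZMod (n + 1) => pderiv i g)).radical := by
    rw [Ideal.radical_eq_sInf, Ideal.mem_sInf]
    rintro P ⟨hle, hP⟩
    rw [Ideal.span_le] at hle
    refine mem_prime_of_cyclic_relations P hd hunit hodd X (hg ▸ hle (.inl rfl)) (fun j => ?_) i
    rw [← pderiv_sum_cyclic hd hdk, ← hg]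
    exact hle (.inr ⟨j, rfl⟩)
  refine ⟨hX, le_antisymm ?_ (Ideal.span_le.2 (Set.range_subset_iff.2 hX))⟩
  have hmem (i : ZMod (n + 1)) :
      X i ∈ Ideal.span (Set.range (X : ZMod (n + 1) → MvPolynomial (ZMod (n + 1)) k)) :=
    Ideal.subset_span ⟨i, rfl⟩
  rw [isRadical_idealOfVars.radical_le_iff, Ideal.span_le, Set.union_subset_iff,
    Set.singleton_subset_iff, Set.range_subset_iff]
  refine ⟨hg ▸ Ideal.sum_mem _ fun j _ => Ideal.mul_mem_left _ _ (hmem _), fun j => ?_⟩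
  rw [hg, pderiv_sum_cyclic hd hdk]
  exact sub_mem (Ideal.pow_mem_of_mem _ (hmem _) _ (by lia)) (Ideal.mul_mem_left _ _ (hmem _))
end

section
/- Let k be a field of characteristic p > 0, let d ≥ 2 be an integer divisible by p, and let n ≥ 1 with p dividing n+1. In the polynomial ring k[X_0, …, X_n], with indices taken cyclically modulo n+1, let g̃_{n;d} = X_0^d + Σ_{j ∈ Z/(n+1)} X_j^(d−1) · X_{j+1}. Then for every index i, the partial derivative ∂g̃_{n;d}/∂X_i equals ∂g_{n;d}/∂X_i where g_{n;d} = Σ_{j ∈ Z/(n+1)} X_j^(d−1) · X_{j+1}, and the difference g̃_{n;d} − X_0^d lies in the ideal of k[X_0, …, X_n] generated by the partial derivatives ∂g̃_{n;d}/∂X_0, …, ∂g̃_{n;d}/∂X_n. -/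
open MvPolynomial

namespace MvPolynomial

theorem sum_mul_pderiv_eq_mkDerivation {σ R : Type*} [CommSemiring R] [Fintype σ]
    (w : σ → MvPolynomial σ R) (f : MvPolynomial σ R) :
    ∑ i, w i * pderiv i f = mkDerivation R w f := by
  classical
  have h : (∑ i, w i • pderiv i : Derivation R (MvPolynomial σ R) (MvPolynomial σ R)) =
      mkDerivation R w := by
    refine derivation_ext fun j => ?_
    rw [← Derivation.coeFnAddMonoidHom_apply, map_sum, Finset.sum_apply]
    simp [pderiv_X, Pi.single_apply]
  rw [← h, ← Derivation.coeFnAddMonoidHom_apply, map_sum, Finset.sum_apply]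
  simp

theorem mkDerivation_C_mul_X_pow_mul_X {σ R : Type*} [CommRing R] (a : σ → R) (i j : σ) (m : ℕ) :
    mkDerivation R (fun l => C (a l) * X l) (X i ^ m * X j : MvPolynomial σ R) =
      C (m * a i + a j) * (X i ^ m * X j) := by
  rcases m with _ | m
  · simp
  · simp [Derivation.leibniz, Derivation.leibniz_pow]
    ring

end MvPolynomial

/-- For `g̃_{n;d} = X 0 ^ d + ∑_{j ∈ ℤ/(n+1)} X j ^ (d-1) * X (j+1)` over a field of
characteristic `p > 0` with `p ∣ d`, `d ≥ 2`, and `p ∣ n + 1`: the partial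
derivatives of `g̃_{n;d}` coincide with those of
`g_{n;d} = ∑_{j ∈ ℤ/(n+1)} X j ^ (d-1) * X (j+1)`, and `g̃_{n;d} - X 0 ^ d` lies in
the ideal generated by the partial derivatives of `g̃_{n;d}`. -/
theorem cyclic_poly_tilde_pderiv_and_mem (k : Type*) [Field k] (p : ℕ) [CharP k p]
    (hp : 0 < p) (d n : ℕ) (hd : 2 ≤ d) (hpd : p ∣ d) (hn : 1 ≤ n)
    (hpn : p ∣ (n + 1))
    (g gt : MvPolynomial (ZMod (n + 1)) k)
    (hg : g = ∑ j : ZMod (n + 1), X j ^ (d - 1) * X (j + 1))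
    (hgt : gt = X 0 ^ d + g) :
    (∀ i : ZMod (n + 1), pderiv i gt = pderiv i g) ∧
    gt - X 0 ^ d ∈ Ideal.span (Set.range fun i : ZMod (n + 1) => pderiv i gt) := by
  have hd0 : (d : k) = 0 := (CharP.cast_eq_zero_iff k p d).mpr hpd
  have hpderiv (i : ZMod (n + 1)) : pderiv i gt = pderiv i g := by
    have hC : (d : MvPolynomial (ZMod (n + 1)) k) = 0 := by
      rw [← map_natCast (C : k →+* MvPolynomial (ZMod (n + 1)) k), hd0, map_zero]
    simp [hgt, Derivation.leibniz_pow, hC]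
  refine ⟨hpderiv, ?_⟩
  let a : ZMod (n + 1) →+* k := ZMod.castHom hpn k
  have hm : ((d - 1 : ℕ) : k) = -1 := by
    rw [Nat.cast_sub (by omega), hd0]
    simp
  have hD : ∑ i, (C (a i) * X i) * pderiv i g = g := by
    rw [sum_mul_pderiv_eq_mkDerivation, hg, map_sum]
    refine Finset.sum_congr rfl fun j _ => ?_
    rw [mkDerivation_C_mul_X_pow_mul_X (fun l => a l), hm, map_add a, map_one a]
    simp
  rw [hgt, add_sub_cancel_left, ← hgt]
  nth_rw 1 [← hD]
  refine Ideal.sum_mem _ fun i _ => Ideal.mul_mem_left _ _ ?_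
  rw [← hpderiv i]
  exact Ideal.subset_span ⟨i, rfl⟩
end

section
/- Let K be a field of characteristic p > 0 and let A be a nontrivial commutative K-algebra that is finite-dimensional as a K-vector space, such that p does not divide dim_K A. Then there exists a maximal ideal m of A such that the residue field A/m is a finite field extension of K whose degree [A/m : K] is not divisible by p; in particular, A/m is a separable field extension of K. -/
/-- A finite extension whose degree is not divisible by the positive characteristic is separable. -/
theorem Algebra.isSeparable_of_not_dvd_finrank (K L : Type*) [Field K] [Field L] [Algebra K L]
    [FiniteDimensional K L] (p : ℕ) [Fact p.Prime] [CharP K p]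
    (h : ¬ p ∣ Module.finrank K L) : Algebra.IsSeparable K L := by
  have : ExpChar K p := ExpChar.prime Fact.out
  rw [isSeparable_iff_finInsepDegree_eq_one]
  obtain ⟨n, hn⟩ := finInsepDegree_eq_pow (F := K) (E := L) p
  rcases n.eq_zero_or_pos with rfl | hpos
  · simpa using hn
  · refine absurd ?_ h
    rw [← Field.finSepDegree_mul_finInsepDegree K L, hn]
    exact (dvd_pow_self p hpos.ne').mul_left _

/-- If a natural number divides the degrees of all residue fields of a finite-dimensional
commutative algebra, then it divides the dimension of every finitely generated module. -/
theorem Module.dvd_finrank_of_forall_isMaximal (K : Type*) {A : Type*} [Field K] [CommRing A]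
    [Algebra K A] [FiniteDimensional K A] (n : ℕ)
    (h : ∀ m : Ideal A, m.IsMaximal → n ∣ Module.finrank K (A ⧸ m))
    (M : Type*) [AddCommGroup M] [Module A M] [Module K M] [IsScalarTower K A M]
    [hM : Module.Finite A M] : n ∣ Module.finrank K M := by
  have : IsArtinianRing A := IsArtinianRing.of_finite K A
  refine IsNoetherianRing.induction_on_isQuotientEquivQuotientPrime A
    (motive := fun N _ _ _ ↦ ∀ [Module K N] [IsScalarTower K A N], n ∣ Module.finrank K N)
    hM ?_ ?_ ?_
  · intro N _ _ _ _ _ _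
    simp [Module.finrank_zero_of_subsingleton]
  · intro N _ _ _ P e _ _
    rw [(e.restrictScalars K).finrank_eq]
    exact h _ inferInstance
  · intro N₁ _ _ _ N₂ _ _ _ N₃ _ _ _ f g hf hg hfg h₁ h₃ _ _
    let : Module K N₁ := Module.compHom N₁ (algebraMap K A)
    let : Module K N₃ := Module.compHom N₃ (algebraMap K A)
    have : IsScalarTower K A N₁ := .of_algebraMap_smul fun _ _ ↦ rfl
    have : IsScalarTower K A N₃ := .of_algebraMap_smul fun _ _ ↦ rfl
    have : FiniteDimensional K N₂ := Module.Finite.trans A N₂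
    have hker : (g.restrictScalars K).ker = (f.restrictScalars K).range :=
      (LinearMap.exact_iff (f := f.restrictScalars K) (g := g.restrictScalars K)).mp hfg
    rw [← (g.restrictScalars K).finrank_range_add_finrank_ker, hker,
      LinearMap.finrank_range_of_inj (f := f.restrictScalars K) hf,
      (LinearMap.range_eq_top (f := g.restrictScalars K)).mpr hg, finrank_top]
    exact h₃.add h₁


/-- If `A` is a nontrivial finite-dimensional commutative algebra over a field `K`
of characteristic `p > 0` with `p ∤ dim_K A`, then `A` has a maximal ideal `m`
whose residue field `A ⧸ m` is a finite extension of `K` of degree prime to `p`;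
in particular `A ⧸ m` is separable over `K`. -/
theorem exists_maximalIdeal_residue_degree_not_dvd (K : Type*) [Field K] (p : ℕ)
    [CharP K p] (hp : 0 < p)
    (A : Type*) [CommRing A] [Nontrivial A] [Algebra K A] [FiniteDimensional K A]
    (hdim : ¬ p ∣ Module.finrank K A) :
    ∃ m : Ideal A, m.IsMaximal ∧ FiniteDimensional K (A ⧸ m) ∧
      ¬ p ∣ Module.finrank K (A ⧸ m) ∧ Algebra.IsSeparable K (A ⧸ m) := by
  have : Fact p.Prime := ⟨(CharP.char_is_prime_or_zero K p).resolve_right hp.ne'⟩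
  obtain ⟨m, hm, hmp⟩ : ∃ m : Ideal A, m.IsMaximal ∧ ¬ p ∣ Module.finrank K (A ⧸ m) := by
    by_contra! hcon
    exact hdim (Module.dvd_finrank_of_forall_isMaximal K p hcon A)
  let := Ideal.Quotient.field m
  exact ⟨m, hm, inferInstance, hmp, Algebra.isSeparable_of_not_dvd_finrank K (A ⧸ m) p hmp⟩
end
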